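/- Fix input distributions P_{X_1},…,P_{X_K}, a subset 𝒦′ ⊆ 𝒦 with 𝒦̄′ = 𝒦∖𝒦′, and rates Q_1,…,Q_K ≥ 0 such that Q_k = 0 for all k ∈ 𝒦̄′ and ∑_{k∈S} Q_k > I(X_S;Z|X_{𝒦̄′}) for every nonempty S ⊆ 𝒦′ (mutual informations computed for X_𝒦 ~ ∏_k P_{X_k} and Z the corresponding single-letter channel output). Then there exist ε > 0 and N such that for every blocklength n ≥ N there exist deterministic codebooks c_𝒦 (i.e., fixed realizations of the random codebooks) with ‖P_{Z^n}(·|c_𝒦) − P_{Z^n}(·|c_{𝒦̄′})‖₁ ≤ e^{−nε}. -/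

import Mathlib

open scoped Classical

noncomputable section

/-- Probability that random variable `X` takes value `x`, under pmf `p` on a finite sample space. -/
def probOf {Ω α : Type} [Fintype Ω] (p : Ω → ℝ) (X : Ω → α) (x : α) : ℝ :=
  ∑ ω, if X ω = x then p ω else 0

/-- Shannon entropy (base 2) of a finitely-valued random variable. -/
def Hent {Ω α : Type} [Fintype Ω] [Fintype α] (p : Ω → ℝ) (X : Ω → α) : ℝ :=
  -∑ x, probOf p X x * Real.logb 2 (probOf p X x)

/-- Conditional entropy `H(X | C)`. -/
def condHent {Ω α γ : Type} [Fintype Ω] [Fintype α] [Fintype γ]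
    (p : Ω → ℝ) (X : Ω → α) (C : Ω → γ) : ℝ :=
  Hent p (fun ω => (X ω, C ω)) - Hent p C

/-- Conditional mutual information `I(A;B | C)`. -/
def IcondMut {Ω α β γ : Type} [Fintype Ω] [Fintype α] [Fintype β] [Fintype γ]
    (p : Ω → ℝ) (A : Ω → α) (B : Ω → β) (C : Ω → γ) : ℝ :=
  condHent p A C + condHent p B C - condHent p (fun ω => (A ω, B ω)) C

/-- Mutual information `I(A;B)`. -/
def Imut {Ω α β : Type} [Fintype Ω] [Fintype α] [Fintype β]
    (p : Ω → ℝ) (A : Ω → α) (B : Ω → β) : ℝ :=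
  Hent p A + Hent p B - Hent p (fun ω => (A ω, B ω))

/-- The tuple `X_S = (X_k)_{k ∈ S}` as a random variable. -/
def tup {Ω ι : Type} {𝒳 : ι → Type} (X : ∀ k, Ω → 𝒳 k) (S : Finset ι) :
    Ω → ∀ k : S, 𝒳 k.1 :=
  fun ω k => X k.1 ω

/-- Size of the message set of user `k` at blocklength `n` and rate `Q k`: `⌈2^{n Q_k}⌉`. -/
def Msize {K : ℕ} (Q : Fin K → ℝ) (n : ℕ) (k : Fin K) : ℕ :=
  ⌈(2 : ℝ) ^ ((n : ℝ) * Q k)⌉₊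

/-- `n`-fold memoryless extension of the channel `W`. -/
def Wn {K : ℕ} {𝒳 : Fin K → Type} {𝒵 : Type}
    (W : (∀ k, 𝒳 k) → 𝒵 → ℝ) (n : ℕ) (x : ∀ k, Fin n → 𝒳 k) (z : Fin n → 𝒵) : ℝ :=
  ∏ i, W (fun k => x k i) (z i)

/-- Probability of a realization `c` of the collection of random codebooks. -/
def cbProb {K : ℕ} {𝒳 : Fin K → Type} [∀ k, Fintype (𝒳 k)]
    (P : ∀ k, 𝒳 k → ℝ) (Q : Fin K → ℝ) (n : ℕ)
    (c : ∀ k, Fin (Msize Q n k) → Fin n → 𝒳 k) : ℝ :=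
  ∏ k, ∏ m, ∏ i, P k (c k m i)

/-- Output distribution `P_{Z^n}(·|C_𝒦)` induced by the full collection of codebooks. -/
def PoutFull {K : ℕ} {𝒳 : Fin K → Type} [∀ k, Fintype (𝒳 k)] {𝒵 : Type}
    (W : (∀ k, 𝒳 k) → 𝒵 → ℝ) (Q : Fin K → ℝ) (n : ℕ)
    (c : ∀ k, Fin (Msize Q n k) → Fin n → 𝒳 k) (z : Fin n → 𝒵) : ℝ :=
  (∏ k, (Msize Q n k : ℝ))⁻¹ *
    ∑ m : ∀ k, Fin (Msize Q n k), Wn W n (fun k i => c k (m k) i) z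

/-- Output distribution `P_{Z^n}(·|C_{𝒦̄′})` induced by the codebooks of the users outside `K'`,
with the inputs of users in `K'` drawn i.i.d. from their input distributions. -/
def PoutPartial {K : ℕ} {𝒳 : Fin K → Type} [∀ k, Fintype (𝒳 k)] {𝒵 : Type}
    (W : (∀ k, 𝒳 k) → 𝒵 → ℝ) (P : ∀ k, 𝒳 k → ℝ) (Q : Fin K → ℝ)
    (K' : Finset (Fin K)) (n : ℕ)
    (c : ∀ k, Fin (Msize Q n k) → Fin n → 𝒳 k) (z : Fin n → 𝒵) : ℝ :=
  (∏ k ∈ Finset.univ \ K', (Msize Q n k : ℝ))⁻¹ *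
    ∑ m : ∀ k : (Finset.univ \ K' : Finset (Fin K)), Fin (Msize Q n k.1),
      ∑ x : ∀ k : K', Fin n → 𝒳 k.1,
        (∏ k : K', ∏ i, P k.1 (x k i)) *
          Wn W n (fun k i =>
            if h : k ∈ K' then x ⟨k, h⟩ i
            else c k (m ⟨k, Finset.mem_sdiff.mpr ⟨Finset.mem_univ k, h⟩⟩) i) z

section ProductLaw

set_option linter.unusedSectionVars false

variable {ι : Type} [Fintype ι] [DecidableEq ι] {Y : ι → Type} [∀ k, Fintype (Y k)]

/-- The product of the laws `p k`. -/
def prodLaw (p : ∀ k, Y k → ℝ) (x : ∀ k, Y k) : ℝ := ∏ k, p k (x k)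

/-- Conditional expectation of `f` given the coordinates in `S`, under the product law. -/
def condAvg (p : ∀ k, Y k → ℝ) (S : Finset ι) (f : (∀ k, Y k) → ℝ) (x : ∀ k, Y k) : ℝ :=
  ∑ y, prodLaw p y * f (S.piecewise x y)

/-- The law of a family of independent codebooks with independent codewords. -/
def codeLaw (p : ∀ k, Y k → ℝ) (M : ι → ℕ) (c : ∀ k, Fin (M k) → Y k) : ℝ :=
  prodLaw (fun k (d : Fin (M k) → Y k) => ∏ m, p k (d m)) c

variable {p : ∀ k, Y k → ℝ}

theorem sum_prod_apply (f : ∀ k, Y k → ℝ) : ∑ x : ∀ k, Y k, ∏ k, f k (x k) = ∏ k, ∑ y, f k y := by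
  rw [Finset.prod_univ_sum, Fintype.piFinset_univ]

theorem sum_prodLaw (hp : ∀ k, (∀ y, 0 ≤ p k y) ∧ ∑ y, p k y = 1) : ∑ x, prodLaw p x = 1 := by
  simp only [prodLaw, sum_prod_apply, (hp _).2, Finset.prod_const_one]

theorem prodLaw_nonneg (hp : ∀ k, (∀ y, 0 ≤ p k y) ∧ ∑ y, p k y = 1) (x : ∀ k, Y k) :
    0 ≤ prodLaw p x :=
  Finset.prod_nonneg fun k _ => (hp k).1 _

theorem codeLaw_isPmf (hp : ∀ k, (∀ y, 0 ≤ p k y) ∧ ∑ y, p k y = 1) (M : ι → ℕ) (k : ι) :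
    (∀ d : Fin (M k) → Y k, 0 ≤ ∏ m, p k (d m)) ∧ ∑ d : Fin (M k) → Y k, ∏ m, p k (d m) = 1 :=
  ⟨fun _ => Finset.prod_nonneg fun _ _ => (hp k).1 _, by
    rw [sum_prod_apply (fun _ : Fin (M k) => p k)]; simp [(hp k).2]⟩

theorem condAvg_nonneg (hp : ∀ k, (∀ y, 0 ≤ p k y) ∧ ∑ y, p k y = 1) (S : Finset ι)
    {f : (∀ k, Y k) → ℝ} (hf : ∀ x, 0 ≤ f x) (x : ∀ k, Y k) : 0 ≤ condAvg p S f x :=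
  Finset.sum_nonneg fun _ _ => mul_nonneg (prodLaw_nonneg hp _) (hf _)

theorem condAvg_mono (hp : ∀ k, (∀ y, 0 ≤ p k y) ∧ ∑ y, p k y = 1) (S : Finset ι)
    {f g : (∀ k, Y k) → ℝ} (h : ∀ x, f x ≤ g x) (x : ∀ k, Y k) :
    condAvg p S f x ≤ condAvg p S g x :=
  Finset.sum_le_sum fun _ _ => mul_le_mul_of_nonneg_left (h _) (prodLaw_nonneg hp _)

theorem piecewise_piecewise_of_subset {S U : Finset ι} (h : U ⊆ S) (x y z : ∀ k, Y k) :
    U.piecewise (S.piecewise x y) z = U.piecewise x z := by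
  ext k
  by_cases hk : k ∈ U
  · simp [hk, h hk]
  · simp [hk]

theorem condAvg_piecewise (p : ∀ k, Y k → ℝ) {S U : Finset ι} (h : U ⊆ S)
    (f : (∀ k, Y k) → ℝ) (x y : ∀ k, Y k) :
    condAvg p U f (S.piecewise x y) = condAvg p U f x := by
  simp only [condAvg, piecewise_piecewise_of_subset h]

theorem condAvg_congr (p : ∀ k, Y k → ℝ) {U : Finset ι} (f : (∀ k, Y k) → ℝ) {x y : ∀ k, Y k}
    (h : ∀ k ∈ U, x k = y k) : condAvg p U f x = condAvg p U f y := by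
  unfold condAvg
  refine Finset.sum_congr rfl fun x' _ => ?_
  congr 2
  ext k
  by_cases hk : k ∈ U
  · simp [hk, h k hk]
  · simp [hk]

theorem condAvg_univ (hp : ∀ k, (∀ y, 0 ≤ p k y) ∧ ∑ y, p k y = 1) (f : (∀ k, Y k) → ℝ) :
    condAvg p Finset.univ f = f := by
  ext x
  simp [condAvg, ← Finset.sum_mul, sum_prodLaw hp]

theorem condAvg_add (p : ∀ k, Y k → ℝ) (S : Finset ι) (f g : (∀ k, Y k) → ℝ) (x : ∀ k, Y k) :
    condAvg p S (fun x => f x + g x) x = condAvg p S f x + condAvg p S g x := by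
  simp only [condAvg, mul_add, Finset.sum_add_distrib]

theorem condAvg_sub (p : ∀ k, Y k → ℝ) (S : Finset ι) (f g : (∀ k, Y k) → ℝ) (x : ∀ k, Y k) :
    condAvg p S (fun x => f x - g x) x = condAvg p S f x - condAvg p S g x := by
  simp only [condAvg, mul_sub, Finset.sum_sub_distrib]

theorem condAvg_mul_left (p : ∀ k, Y k → ℝ) (S : Finset ι) (f h : (∀ k, Y k) → ℝ)
    (hh : ∀ x x', h (S.piecewise x x') = h x) (x : ∀ k, Y k) :
    condAvg p S (fun x => h x * f x) x = h x * condAvg p S f x := by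
  simp only [condAvg, hh, Finset.mul_sum]
  exact Finset.sum_congr rfl fun _ _ => by ring

theorem condAvg_of_invariant (hp : ∀ k, (∀ y, 0 ≤ p k y) ∧ ∑ y, p k y = 1) (S : Finset ι)
    (h : (∀ k, Y k) → ℝ) (hh : ∀ x x', h (S.piecewise x x') = h x) (x : ∀ k, Y k) :
    condAvg p S h x = h x := by
  simp only [condAvg, hh, ← Finset.sum_mul, sum_prodLaw hp, one_mul]

/-- Exchange of the coordinates outside `S`. -/
def swapOff (S : Finset ι) : ((∀ k, Y k) × (∀ k, Y k)) ≃ ((∀ k, Y k) × (∀ k, Y k)) where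
  toFun q := (S.piecewise q.1 q.2, S.piecewise q.2 q.1)
  invFun q := (S.piecewise q.1 q.2, S.piecewise q.2 q.1)
  left_inv q := by
    refine Prod.ext ?_ ?_ <;> ext k <;> by_cases hk : k ∈ S <;> simp [hk]
  right_inv q := by
    refine Prod.ext ?_ ?_ <;> ext k <;> by_cases hk : k ∈ S <;> simp [hk]

theorem prodLaw_swapOff (p : ∀ k, Y k → ℝ) (S : Finset ι) (x x' : ∀ k, Y k) :
    prodLaw p (S.piecewise x x') * prodLaw p (S.piecewise x' x) = prodLaw p x * prodLaw p x' := by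
  simp only [prodLaw, ← Finset.prod_mul_distrib]
  refine Finset.prod_congr rfl fun k _ => ?_
  by_cases hk : k ∈ S <;> simp [hk, mul_comm]

theorem sum_mul_condAvg (hp : ∀ k, (∀ y, 0 ≤ p k y) ∧ ∑ y, p k y = 1) (S : Finset ι)
    (f : (∀ k, Y k) → ℝ) :
    ∑ x, prodLaw p x * condAvg p S f x = ∑ x, prodLaw p x * f x := by
  calc ∑ x, prodLaw p x * condAvg p S f x
      = ∑ q : (∀ k, Y k) × (∀ k, Y k),
          prodLaw p q.1 * prodLaw p q.2 * f (S.piecewise q.1 q.2) := by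
        simp only [condAvg, Finset.mul_sum, Fintype.sum_prod_type, mul_assoc]
    _ = ∑ q : (∀ k, Y k) × (∀ k, Y k), prodLaw p q.1 * prodLaw p q.2 * f q.1 := by
        refine Fintype.sum_equiv (swapOff S) _ _ fun q => ?_
        simp only [swapOff, Equiv.coe_fn_mk, prodLaw_swapOff]
    _ = ∑ x, prodLaw p x * f x := by
        rw [Fintype.sum_prod_type]
        refine Finset.sum_congr rfl fun x _ => ?_
        calc _ = ∑ x', prodLaw p x' * (prodLaw p x * f x) :=
              Finset.sum_congr rfl fun _ _ => by ring
          _ = _ := by rw [← Finset.sum_mul, sum_prodLaw hp, one_mul]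

theorem sum_mul_mul_condAvg (hp : ∀ k, (∀ y, 0 ≤ p k y) ∧ ∑ y, p k y = 1) (S : Finset ι)
    (f h : (∀ k, Y k) → ℝ) (hh : ∀ x x', h (S.piecewise x x') = h x) :
    ∑ x, prodLaw p x * (h x * condAvg p S f x) = ∑ x, prodLaw p x * (h x * f x) := by
  rw [← sum_mul_condAvg hp S (fun x => h x * f x)]
  simp only [condAvg_mul_left p S f h hh]

theorem sum_prodLaw_indicator (hp : ∀ k, (∀ y, 0 ≤ p k y) ∧ ∑ y, p k y = 1) (S : Finset ι)
    (a : ∀ k, Y k) (f : (∀ k, Y k) → ℝ) :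
    (∑ x, if ∀ k ∈ S, x k = a k then prodLaw p x * f x else 0) =
      (∏ k ∈ S, p k (a k)) * condAvg p S f a := by
  have h1 : ∀ x : ∀ k, Y k, (if ∀ k ∈ S, x k = a k then (1 : ℝ) else 0) =
      ∏ k, if k ∈ S then (if x k = a k then 1 else 0) else 1 := by
    intro x
    rw [Finset.prod_ite_mem, Finset.univ_inter, Finset.prod_ite_zero]
    simp
  have h2 : ∑ x, prodLaw p x * (if ∀ k ∈ S, x k = a k then (1 : ℝ) else 0) =
      ∏ k ∈ S, p k (a k) := by
    simp only [h1, prodLaw, ← Finset.prod_mul_distrib]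
    rw [sum_prod_apply (fun k y => p k y * if k ∈ S then (if y = a k then 1 else 0) else 1),
      ← Finset.univ_inter S, ← Finset.prod_ite_mem]
    refine Finset.prod_congr rfl fun k _ => ?_
    by_cases hk : k ∈ S <;> simp [hk, (hp k).2]
  rw [← h2, Finset.sum_mul]
  have h3 := sum_mul_mul_condAvg hp S f (fun x => if ∀ k ∈ S, x k = a k then (1 : ℝ) else 0) (by
    intro x x'
    refine if_congr (forall₂_congr fun k hk => ?_) rfl rfl
    simp [hk])
  trans ∑ x, prodLaw p x * ((if ∀ k ∈ S, x k = a k then (1 : ℝ) else 0) * f x)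
  · exact Finset.sum_congr rfl fun x _ => by split_ifs <;> simp
  · rw [← h3]
    refine Finset.sum_congr rfl fun x _ => ?_
    split_ifs with h
    · rw [condAvg_congr p f h]; ring
    · simp

theorem sum_codebook_pair {Y₀ : Type} [Fintype Y₀] {q : Y₀ → ℝ} (hq : ∑ y, q y = 1) {M : ℕ}
    (m m' : Fin M) (a b : Y₀) :
    ∑ d : Fin M → Y₀, (∏ j, q (d j)) *
        ((if d m = a then 1 else 0) * (if d m' = b then 1 else 0)) =
      q a * (if m = m' then (if a = b then 1 else 0) else q b) := by
  have h : ∀ d : Fin M → Y₀, (∏ j, q (d j)) *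
      ((if d m = a then 1 else 0) * (if d m' = b then 1 else 0)) =
      ∏ j, (q (d j) * ((if j = m then (if d j = a then 1 else 0) else 1) *
        (if j = m' then (if d j = b then 1 else 0) else 1))) := by
    intro d
    rw [Finset.prod_mul_distrib, Finset.prod_mul_distrib]
    simp
  simp only [h]
  rw [sum_prod_apply (fun j y => q y * ((if j = m then (if y = a then 1 else 0) else 1) *
        (if j = m' then (if y = b then 1 else 0) else 1)))]
  by_cases hm : m = m'
  · subst hm
    rw [Finset.prod_eq_single m (fun j _ hj => by simp [hj, hq]) (by simp)]
    simp only [if_true, ite_mul, one_mul, zero_mul]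
    rw [Finset.sum_eq_single a (fun y _ hy => by simp [hy]) (by simp)]
    simp
  · rw [Finset.prod_eq_mul m m' hm (fun j _ hj => by simp [hj.1, hj.2, hq]) (by simp) (by simp)]
    simp [hm, Ne.symm hm]

theorem sum_codeLaw_pair (hp : ∀ k, (∀ y, 0 ≤ p k y) ∧ ∑ y, p k y = 1) (M : ι → ℕ)
    (m m' : ∀ k, Fin (M k)) (f : (∀ k, Y k) → (∀ k, Y k) → ℝ) :
    ∑ c, codeLaw p M c * f (fun k => c k (m k)) (fun k => c k (m' k)) =
      ∑ x, ∑ x', prodLaw p x * prodLaw p x' *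
        f x ((Finset.univ.filter fun k => m k = m' k).piecewise x x') := by
  have ind : ∀ u v : ∀ k, Y k, f u v = ∑ a, ∑ b, f a b *
      ∏ k, ((if u k = a k then (1 : ℝ) else 0) * (if v k = b k then 1 else 0)) := by
    intro u v
    have h : ∀ a b : ∀ k, Y k,
        ∏ k, ((if u k = a k then (1 : ℝ) else 0) * (if v k = b k then 1 else 0)) =
        (if u = a then 1 else 0) * (if v = b then 1 else 0) := by
      intro a b
      rw [Finset.prod_mul_distrib, Finset.prod_ite_zero, Finset.prod_ite_zero]
      simp [funext_iff]
    simp only [h]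
    simp
  have L : ∑ c, codeLaw p M c * f (fun k => c k (m k)) (fun k => c k (m' k)) =
      ∑ a, ∑ b, f a b *
        ∏ k, (p k (a k) * (if m k = m' k then (if a k = b k then 1 else 0) else p k (b k))) := by
    calc _ = ∑ c, ∑ a, ∑ b, f a b * (codeLaw p M c * ∏ k,
          ((if c k (m k) = a k then (1 : ℝ) else 0) * (if c k (m' k) = b k then 1 else 0))) := by
          refine Finset.sum_congr rfl fun c _ => ?_
          rw [ind (fun k => c k (m k))]
          simp only [Finset.mul_sum]
          exact Finset.sum_congr rfl fun a _ => Finset.sum_congr rfl fun b _ => by ring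
      _ = _ := by
          rw [Finset.sum_comm]
          refine Finset.sum_congr rfl fun a _ => ?_
          rw [Finset.sum_comm]
          refine Finset.sum_congr rfl fun b _ => ?_
          rw [← Finset.mul_sum]
          congr 1
          simp only [codeLaw, prodLaw, ← Finset.prod_mul_distrib]
          rw [sum_prod_apply (fun k (d : Fin (M k) → Y k) => (∏ j, p k (d j)) *
            ((if d (m k) = a k then 1 else 0) * (if d (m' k) = b k then 1 else 0)))]
          exact Finset.prod_congr rfl fun k _ => sum_codebook_pair (hp k).2 _ _ _ _
  rw [L]
  refine Finset.sum_congr rfl fun a _ => ?_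
  symm
  set S := Finset.univ.filter fun k => m k = m' k with hS
  calc ∑ x', prodLaw p a * prodLaw p x' * f a (S.piecewise a x')
      = ∑ x', ∑ b, f a b * (prodLaw p a * prodLaw p x' *
          ∏ k, (if S.piecewise a x' k = b k then (1 : ℝ) else 0)) := by
        refine Finset.sum_congr rfl fun x' _ => ?_
        rw [Finset.sum_eq_single (S.piecewise a x')]
        · simp; ring
        · intro b _ hb
          rw [Finset.prod_ite_zero, if_neg]
          · simp
          · intro h; exact hb (funext fun k => (h k (Finset.mem_univ k)).symm)
        · simp
    _ = _ := by
        rw [Finset.sum_comm]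
        refine Finset.sum_congr rfl fun b _ => ?_
        rw [← Finset.mul_sum]
        congr 1
        simp only [prodLaw, ← Finset.prod_mul_distrib]
        have : ∀ x' : ∀ k, Y k,
            ∏ k, (p k (a k) * p k (x' k) * if S.piecewise a x' k = b k then (1 : ℝ) else 0) =
            ∏ k, (p k (a k) * p k (x' k) *
              if (if m k = m' k then a k else x' k) = b k then (1 : ℝ) else 0) := by
          intro x'
          refine Finset.prod_congr rfl fun k _ => ?_
          simp [Finset.piecewise, hS]
        simp only [this]
        rw [sum_prod_apply (fun k y => p k (a k) * p k y *
              if (if m k = m' k then a k else y) = b k then (1 : ℝ) else 0)]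
        refine Finset.prod_congr rfl fun k _ => ?_
        by_cases hk : m k = m' k
        · simp only [hk, if_true]
          rw [← Finset.sum_mul, ← Finset.mul_sum, (hp k).2, mul_one]
        · simp [hk]

theorem sum_codeLaw_apply (hp : ∀ k, (∀ y, 0 ≤ p k y) ∧ ∑ y, p k y = 1) (M : ι → ℕ)
    (m : ∀ k, Fin (M k)) (f : (∀ k, Y k) → ℝ) :
    ∑ c, codeLaw p M c * f (fun k => c k (m k)) = ∑ x, prodLaw p x * f x := by
  rw [sum_codeLaw_pair hp M m m (fun x _ => f x)]
  refine Finset.sum_congr rfl fun x _ => ?_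
  rw [← Finset.sum_mul, ← Finset.mul_sum, sum_prodLaw hp, mul_one]

end ProductLaw

section SoftCovering

set_option linter.unusedSectionVars false

variable {ι : Type} [Fintype ι] [DecidableEq ι] {Y : ι → Type} [∀ k, Fintype (Y k)]
  {p : ∀ k, Y k → ℝ} {M : ι → ℕ} {U : Finset ι}

/-- Average of `f` over all codeword tuples of the codebooks `c`. -/
def codeAvg (c : ∀ k, Fin (M k) → Y k) (f : (∀ k, Y k) → ℝ) : ℝ :=
  (∏ k, (M k : ℝ))⁻¹ * ∑ m : ∀ k, Fin (M k), f (fun k => c k (m k))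

/-- The tuple of first codewords. -/
def headWord (hM : ∀ k, 0 < M k) (c : ∀ k, Fin (M k) → Y k) : ∀ k, Y k :=
  fun k => c k ⟨0, hM k⟩

theorem codeAvg_const (hM : ∀ k, 0 < M k) (c : ∀ k, Fin (M k) → Y k) (a : ℝ) :
    codeAvg c (fun _ => a) = a := by
  have : (∏ k, (M k : ℝ)) ≠ 0 := Finset.prod_ne_zero_iff.2 fun k _ => by
    exact_mod_cast (hM k).ne'
  simp [codeAvg, Fintype.card_pi, this]

theorem codeAvg_add (c : ∀ k, Fin (M k) → Y k) (f g : (∀ k, Y k) → ℝ) :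
    codeAvg c (fun x => f x + g x) = codeAvg c f + codeAvg c g := by
  simp only [codeAvg, Finset.sum_add_distrib, mul_add]

theorem codeAvg_nonneg (c : ∀ k, Fin (M k) → Y k) {f : (∀ k, Y k) → ℝ} (hf : ∀ x, 0 ≤ f x) :
    0 ≤ codeAvg c f :=
  mul_nonneg (by positivity) (Finset.sum_nonneg fun _ _ => hf _)

theorem codeword_eq_of_mem (hU : ∀ k ∈ U, M k = 1) (m m' : ∀ k, Fin (M k)) {k : ι} (hk : k ∈ U) :
    m k = m' k := by
  have := hU k hk
  have h1 := (m k).2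
  have h2 := (m' k).2
  exact Fin.ext (by omega)

theorem sum_codeLaw_codeAvg (hp : ∀ k, (∀ y, 0 ≤ p k y) ∧ ∑ y, p k y = 1) (hM : ∀ k, 0 < M k)
    (f : (∀ k, Y k) → ℝ) :
    ∑ c : ∀ k, Fin (M k) → Y k, codeLaw p M c * codeAvg c f = ∑ x, prodLaw p x * f x := by
  have : (∏ k, (M k : ℝ)) ≠ 0 := Finset.prod_ne_zero_iff.2 fun k _ => by
    exact_mod_cast (hM k).ne'
  calc _ = (∏ k, (M k : ℝ))⁻¹ * ∑ m : ∀ k, Fin (M k), ∑ c : ∀ k, Fin (M k) → Y k,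
          codeLaw p M c * f (fun k => c k (m k)) := by
        rw [Finset.sum_comm, Finset.mul_sum]
        refine Finset.sum_congr rfl fun c _ => ?_
        rw [codeAvg, ← Finset.mul_sum]; ring
    _ = _ := by
        simp only [sum_codeLaw_apply hp]
        simp [Fintype.card_pi, this]

theorem sum_mul_condAvg_centered (hp : ∀ k, (∀ y, 0 ≤ p k y) ∧ ∑ y, p k y = 1) {S : Finset ι}
    (hUS : U ⊆ S) (B : (∀ k, Y k) → ℝ) :
    ∑ x, prodLaw p x * ((B x - condAvg p U B x) *
        condAvg p S (fun x => B x - condAvg p U B x) x) =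
      ∑ x, prodLaw p x * (B x * condAvg p S B x) -
        ∑ x, prodLaw p x * (condAvg p U B x * condAvg p U B x) := by
  have inv : ∀ x x', condAvg p U B (S.piecewise x x') = condAvg p U B x :=
    fun x x' => condAvg_piecewise p hUS B x x'
  have e1 := sum_mul_mul_condAvg hp S B (condAvg p U B) inv
  have e2 := sum_mul_mul_condAvg hp U B (condAvg p U B)
    (fun x x' => condAvg_piecewise p subset_rfl B x x')
  have e3 : ∀ x, condAvg p S (fun x => B x - condAvg p U B x) x =
      condAvg p S B x - condAvg p U B x := by
    intro x
    rw [condAvg_sub, condAvg_of_invariant hp S _ inv]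
  have e4 : ∀ x, prodLaw p x * ((B x - condAvg p U B x) *
        condAvg p S (fun x => B x - condAvg p U B x) x) =
      prodLaw p x * (B x * condAvg p S B x) - prodLaw p x * (condAvg p U B x * B x) -
      prodLaw p x * (condAvg p U B x * condAvg p S B x) +
      prodLaw p x * (condAvg p U B x * condAvg p U B x) := by
    intro x; rw [e3]; ring
  simp only [e4, Finset.sum_add_distrib, Finset.sum_sub_distrib]
  linarith

theorem card_agreeing (m : ∀ k, Fin (M k)) (S : Finset ι) :
    ((Finset.univ.filter fun m' : ∀ k, Fin (M k) => ∀ k ∈ S, m k = m' k).card : ℝ) =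
      ∏ k, if k ∈ S then 1 else (M k : ℝ) := by
  have : (Finset.univ.filter fun m' : ∀ k, Fin (M k) => ∀ k ∈ S, m k = m' k) =
      Fintype.piFinset fun k => if k ∈ S then {m k} else Finset.univ := by
    ext m'
    simp only [Finset.mem_filter, Finset.mem_univ, true_and, Fintype.mem_piFinset]
    refine forall_congr' fun k => ?_
    by_cases hk : k ∈ S <;> simp [hk, eq_comm]
  rw [this, Fintype.card_piFinset, Nat.cast_prod]
  refine Finset.prod_congr rfl fun k _ => ?_
  by_cases hk : k ∈ S <;> simp [hk]

/-- Variance of a codebook average around its conditional mean. -/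
theorem codeAvg_variance_le (hp : ∀ k, (∀ y, 0 ≤ p k y) ∧ ∑ y, p k y = 1) (hM : ∀ k, 0 < M k)
    (hU : ∀ k ∈ U, M k = 1) {B : (∀ k, Y k) → ℝ} (hB : ∀ x, 0 ≤ B x) :
    ∑ c : ∀ k, Fin (M k) → Y k, codeLaw p M c *
        (codeAvg c B - condAvg p U B (headWord hM c)) ^ 2 ≤
      ∑ S ∈ Finset.univ.filter (fun S => U ⊂ S), (∏ k ∈ S, (M k : ℝ))⁻¹ *
        ∑ x, prodLaw p x * (B x * condAvg p S B x) := by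
  set D : (∀ k, Y k) → ℝ := fun x => B x - condAvg p U B x with hD
  set I : ℝ := (∏ k, (M k : ℝ))⁻¹ with hI
  have hMpos : ∀ k, (0 : ℝ) < M k := fun k => by exact_mod_cast hM k
  have hI0 : 0 ≤ I := by positivity
  let T : Finset ι → ℝ := fun S => ∑ x, prodLaw p x * (B x * condAvg p S B x)
  have hT : ∀ S, 0 ≤ T S := fun S => Finset.sum_nonneg fun x _ =>
    mul_nonneg (prodLaw_nonneg hp x) (mul_nonneg (hB x) (condAvg_nonneg hp S hB x))
  have center : ∀ c : ∀ k, Fin (M k) → Y k,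
      codeAvg c B - condAvg p U B (headWord hM c) = codeAvg c D := by
    intro c
    have : codeAvg c B = codeAvg c (fun x => D x + condAvg p U B x) := by simp [hD]
    rw [this, codeAvg_add]
    have : codeAvg c (condAvg p U B) = codeAvg c (fun _ => condAvg p U B (headWord hM c)) := by
      unfold codeAvg
      congr 1
      refine Finset.sum_congr rfl fun m _ => condAvg_congr p B fun k hk => ?_
      simp only [headWord]
      rw [codeword_eq_of_mem hU m (fun k => ⟨0, hM k⟩) hk]
    rw [this, codeAvg_const hM]; ring
  have expand : ∑ c : ∀ k, Fin (M k) → Y k, codeLaw p M c * (codeAvg c D) ^ 2 =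
      I * ∑ m : ∀ k, Fin (M k), (I * ∑ m' : ∀ k, Fin (M k),
        ∑ x, prodLaw p x *
          (D x * condAvg p (Finset.univ.filter fun k => m k = m' k) D x)) := by
    have h1 : ∀ m m' : ∀ k, Fin (M k), ∑ x, prodLaw p x *
          (D x * condAvg p (Finset.univ.filter fun k => m k = m' k) D x) =
        ∑ c, codeLaw p M c * (D (fun k => c k (m k)) * D (fun k => c k (m' k))) := by
      intro m m'
      rw [sum_codeLaw_pair hp M m m' (fun u v => D u * D v)]
      refine Finset.sum_congr rfl fun x _ => ?_
      simp only [condAvg, Finset.mul_sum]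
      exact Finset.sum_congr rfl fun x' _ => by ring
    simp only [h1]
    have h2 : ∀ c : ∀ k, Fin (M k) → Y k, codeLaw p M c * (codeAvg c D) ^ 2 =
        ∑ m : ∀ k, Fin (M k), ∑ m' : ∀ k, Fin (M k),
          I * (I * (codeLaw p M c * (D (fun k => c k (m k)) * D (fun k => c k (m' k))))) := by
      intro c
      rw [codeAvg, mul_pow, sq (∑ m, _), Finset.sum_mul_sum]
      simp only [Finset.mul_sum]
      refine Finset.sum_congr rfl fun m _ => Finset.sum_congr rfl fun m' _ => ?_
      ring
    simp only [h2]
    rw [Finset.sum_comm, Finset.mul_sum]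
    refine Finset.sum_congr rfl fun m _ => ?_
    rw [Finset.sum_comm, Finset.mul_sum, Finset.mul_sum]
    refine Finset.sum_congr rfl fun m' _ => ?_
    rw [Finset.mul_sum, Finset.mul_sum]
  have pair : ∀ m m' : ∀ k, Fin (M k), ∑ x, prodLaw p x *
        (D x * condAvg p (Finset.univ.filter fun k => m k = m' k) D x) ≤
      ∑ S ∈ Finset.univ.filter (fun S => U ⊂ S),
        if ∀ k ∈ S, m k = m' k then T S else 0 := by
    intro m m'
    set S := Finset.univ.filter fun k => m k = m' k with hS
    have hUS : U ⊆ S := fun k hk => by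
      simpa [hS] using codeword_eq_of_mem hU m m' hk
    have hrhs : ∀ R ∈ Finset.univ.filter (fun S => U ⊂ S),
        (0 : ℝ) ≤ if ∀ k ∈ R, m k = m' k then T R else 0 := by
      intro R _; split_ifs
      · exact hT R
      · exact le_rfl
    rw [sum_mul_condAvg_centered hp hUS B]
    by_cases h : U = S
    · rw [← h]
      have := sum_mul_mul_condAvg hp U B (condAvg p U B)
        (fun x x' => condAvg_piecewise p subset_rfl B x x')
      rw [this]
      have : ∑ x, prodLaw p x * (B x * condAvg p U B x) =
        ∑ x, prodLaw p x * (condAvg p U B x * B x) := by simp only [mul_comm (B _)]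
      rw [this, sub_self]
      exact Finset.sum_nonneg hrhs
    · have hmem : S ∈ Finset.univ.filter (fun S => U ⊂ S) := by
        simp [lt_of_le_of_ne hUS h]
      refine le_trans ?_ (Finset.single_le_sum hrhs hmem)
      rw [if_pos (by simp [hS])]
      have : 0 ≤ ∑ x, prodLaw p x * (condAvg p U B x * condAvg p U B x) :=
        Finset.sum_nonneg fun x _ => mul_nonneg (prodLaw_nonneg hp x) (mul_self_nonneg _)
      simp only [T]; linarith
  have inner : ∀ m : ∀ k, Fin (M k), I * ∑ m' : ∀ k, Fin (M k), ∑ x, prodLaw p x *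
        (D x * condAvg p (Finset.univ.filter fun k => m k = m' k) D x) ≤
      ∑ S ∈ Finset.univ.filter (fun S => U ⊂ S), (∏ k ∈ S, (M k : ℝ))⁻¹ * T S := by
    intro m
    refine le_trans (mul_le_mul_of_nonneg_left (Finset.sum_le_sum fun m' _ => pair m m') hI0) ?_
    rw [Finset.sum_comm, Finset.mul_sum]
    refine Finset.sum_le_sum fun S _ => le_of_eq ?_
    rw [← Finset.sum_filter, Finset.sum_const, nsmul_eq_mul, card_agreeing, ← mul_assoc]
    congr 1
    rw [hI, ← Finset.prod_inv_distrib, ← Finset.prod_mul_distrib, ← Finset.prod_inv_distrib,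
      ← Finset.univ_inter S, ← Finset.prod_ite_mem]
    refine Finset.prod_congr rfl fun k _ => ?_
    by_cases hk : k ∈ S <;> simp [hk, (hM k).ne']
  simp only [center]
  rw [expand]
  refine le_trans (mul_le_mul_of_nonneg_left (Finset.sum_le_sum fun m _ => inner m) hI0) ?_
  have : (∏ k, (M k : ℝ)) ≠ 0 := Finset.prod_ne_zero_iff.2 fun k _ => (hMpos k).ne'
  simp [Fintype.card_pi, hI, this, T]

theorem codeAvg_mul_of_condAvg (hM : ∀ k, 0 < M k) (hU : ∀ k ∈ U, M k = 1)
    (c : ∀ k, Fin (M k) → Y k) (f h : (∀ k, Y k) → ℝ)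
    (hh : ∀ x y, (∀ k ∈ U, x k = y k) → h x = h y) :
    codeAvg c (fun x => h x * f x) = h (headWord hM c) * codeAvg c f := by
  have : ∀ m : ∀ k, Fin (M k), h (fun k => c k (m k)) = h (headWord hM c) := fun m =>
    hh _ _ fun k hk => by
      simp only [headWord]
      rw [codeword_eq_of_mem hU m (fun k => ⟨0, hM k⟩) hk]
  simp only [codeAvg, this, ← Finset.mul_sum]
  ring

/-- One-shot soft covering: some codebook family approximates the conditional output law. -/
theorem exists_codebook_of_threshold (hp : ∀ k, (∀ y, 0 ≤ p k y) ∧ ∑ y, p k y = 1)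
    (hM : ∀ k, 0 < M k) (hU : ∀ k ∈ U, M k = 1) {ζ : Type} [Fintype ζ]
    {V : (∀ k, Y k) → ζ → ℝ} (hV0 : ∀ x z, 0 ≤ V x z) (hV1 : ∀ x, ∑ z, V x z = 1)
    {θ : Finset ι → ℝ} (hθ : ∀ S, 0 ≤ θ S) {t : ℝ} (ht : 0 < t) :
    ∃ c : ∀ k, Fin (M k) → Y k,
      ∑ z, |codeAvg c (fun x => V x z) - condAvg p U (fun x => V x z) (headWord hM c)| ≤
        2 * ∑ z, ∑ x, prodLaw p x *
          (if ∃ S, U ⊂ S ∧ θ S * condAvg p U (fun x => V x z) x < condAvg p S (fun x => V x z) x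
            then V x z else 0) +
        (t + (∑ S ∈ Finset.univ.filter (fun S => U ⊂ S), (∏ k ∈ S, (M k : ℝ))⁻¹ * θ S) / t) / 2 := by
  set g : ζ → (∀ k, Y k) → ℝ := fun z => condAvg p U (fun x => V x z) with hg
  let bad : (∀ k, Y k) → ζ → Prop := fun x z =>
    ∃ S, U ⊂ S ∧ θ S * g z x < condAvg p S (fun x => V x z) x
  let Vb : ζ → (∀ k, Y k) → ℝ := fun z x => if bad x z then V x z else 0
  let Vt : ζ → (∀ k, Y k) → ℝ := fun z x => if bad x z then 0 else V x z
  let B : ζ → (∀ k, Y k) → ℝ := fun z x => Vt z x * (√(g z x))⁻¹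
  have hVsplit : ∀ z x, V x z = Vt z x + Vb z x := by
    intro z x; simp only [Vt, Vb]; split_ifs <;> simp
  have hVb : ∀ z x, 0 ≤ Vb z x := by
    intro z x; simp only [Vb]; split_ifs
    · exact hV0 x z
    · exact le_rfl
  have hVt : ∀ z x, 0 ≤ Vt z x := by
    intro z x; simp only [Vt]; split_ifs
    · exact le_rfl
    · exact hV0 x z
  have hVtV : ∀ z x, Vt z x ≤ V x z := fun z x => by rw [hVsplit z x]; linarith [hVb z x]
  have hB : ∀ z x, 0 ≤ B z x := fun z x => mul_nonneg (hVt z x) (by positivity)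
  have hg0 : ∀ z x, 0 ≤ g z x := fun z x => condAvg_nonneg hp U (fun x => hV0 x z) x
  have hVt0 : ∀ z x, g z x = 0 → Vt z x = 0 := by
    intro z x h0
    by_contra hne
    have hnb : ¬ bad x z := fun h => hne (by simp only [Vt]; rw [if_pos h])
    have hVpos : 0 < V x z := lt_of_lt_of_le (lt_of_le_of_ne (hVt z x) (Ne.symm hne)) (hVtV z x)
    by_cases hUu : U = Finset.univ
    · have : g z x = V x z := by simp only [hg, hUu, condAvg_univ hp]
      linarith
    · exact hnb ⟨Finset.univ, lt_of_le_of_ne (Finset.subset_univ U) hUu, by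
        rw [h0, condAvg_univ hp]; simpa using hVpos⟩
  have hVtB : ∀ z x, Vt z x = √(g z x) * B z x := by
    intro z x
    by_cases h0 : g z x = 0
    · simp [B, hVt0 z x h0]
    · have : √(g z x) ≠ 0 := (Real.sqrt_pos.2 (lt_of_le_of_ne (hg0 z x) (Ne.symm h0))).ne'
      simp only [B]; field_simp
  have ginv : ∀ z x y, (∀ k ∈ U, x k = y k) → √(g z x) = √(g z y) := fun z x y h => by
    simp only [hg]; rw [condAvg_congr p _ h]
  have ginv' : ∀ z S, U ⊆ S → ∀ x x', g z (S.piecewise x x') = g z x := fun z S h x x' =>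
    condAvg_piecewise p h _ x x'
  have point : ∀ (c : ∀ k, Fin (M k) → Y k) z,
      |codeAvg c (fun x => V x z) - condAvg p U (fun x => V x z) (headWord hM c)| ≤
      codeAvg c (Vb z) + condAvg p U (Vb z) (headWord hM c) +
        (t * g z (headWord hM c) +
          (codeAvg c (B z) - condAvg p U (B z) (headWord hM c)) ^ 2 / t) / 2 := by
    intro c z
    set y := headWord hM c
    have e1 : codeAvg c (fun x => V x z) = √(g z y) * codeAvg c (B z) + codeAvg c (Vb z) := by
      rw [← codeAvg_mul_of_condAvg hM hU c (B z) (fun x => √(g z x)) (ginv z), ← codeAvg_add]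
      simp only [← hVtB, hVsplit]
    have e2 : condAvg p U (fun x => V x z) y =
        √(g z y) * condAvg p U (B z) y + condAvg p U (Vb z) y := by
      rw [← condAvg_mul_left p U (B z) (fun x => √(g z x))
        (fun x x' => by rw [ginv' z U subset_rfl]), ← condAvg_add]
      simp only [← hVtB, hVsplit]
    have h1 := codeAvg_nonneg c (hVb z)
    have h2 := condAvg_nonneg hp U (hVb z) y
    set a := codeAvg c (B z) - condAvg p U (B z) y with ha
    have key : √(g z y) * |a| ≤ (t * g z y + a ^ 2 / t) / 2 := by
      have hs := Real.sq_sqrt (hg0 z y)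
      have hq : 0 ≤ (t * √(g z y) - |a|) ^ 2 / t := by positivity
      have : (t * √(g z y) - |a|) ^ 2 / t =
          t * √(g z y) ^ 2 + |a| ^ 2 / t - 2 * (√(g z y) * |a|) := by
        field_simp; ring
      rw [this, hs, sq_abs] at hq
      linarith
    have e3 : codeAvg c (fun x => V x z) - condAvg p U (fun x => V x z) y =
        √(g z y) * a + (codeAvg c (Vb z) - condAvg p U (Vb z) y) := by
      rw [e1, e2, ha]; ring
    rw [e3]
    refine (abs_add_le _ _).trans ?_
    rw [abs_mul, abs_of_nonneg (Real.sqrt_nonneg _)]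
    have : |codeAvg c (Vb z) - condAvg p U (Vb z) y| ≤
        codeAvg c (Vb z) + condAvg p U (Vb z) y := by
      rw [abs_le]; constructor <;> linarith
    linarith
  have hc0 : ∀ c : ∀ k, Fin (M k) → Y k, 0 ≤ codeLaw p M c :=
    prodLaw_nonneg (codeLaw_isPmf hp M)
  have head : ∀ f : (∀ k, Y k) → ℝ,
      ∑ c : ∀ k, Fin (M k) → Y k, codeLaw p M c * f (headWord hM c) = ∑ x, prodLaw p x * f x :=
    fun f => sum_codeLaw_apply hp M (fun k => ⟨0, hM k⟩) f
  have second : ∑ z, ∑ c : ∀ k, Fin (M k) → Y k, codeLaw p M c *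
        (codeAvg c (B z) - condAvg p U (B z) (headWord hM c)) ^ 2 ≤
      ∑ S ∈ Finset.univ.filter (fun S => U ⊂ S), (∏ k ∈ S, (M k : ℝ))⁻¹ * θ S := by
    refine le_trans (Finset.sum_le_sum fun z _ => codeAvg_variance_le hp hM hU (hB z)) ?_
    rw [Finset.sum_comm]
    refine Finset.sum_le_sum fun S hS => ?_
    have hUS : U ⊂ S := (Finset.mem_filter.1 hS).2
    rw [← Finset.mul_sum]
    refine mul_le_mul_of_nonneg_left ?_ (by positivity)
    have hpt : ∀ z x, B z x * condAvg p S (B z) x ≤ V x z * θ S := by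
      intro z x
      have e : condAvg p S (B z) x = (√(g z x))⁻¹ * condAvg p S (Vt z) x := by
        rw [← condAvg_mul_left p S (Vt z) (fun x => (√(g z x))⁻¹)
          (fun x x' => by rw [ginv' z S hUS.1])]
        simp only [B, mul_comm]
      by_cases hb : bad x z
      · have : B z x = 0 := by simp only [B, Vt]; rw [if_pos hb]; simp
        rw [this, zero_mul]; exact mul_nonneg (hV0 x z) (hθ S)
      by_cases h0 : g z x = 0
      · have : B z x = 0 := by simp only [B, hVt0 z x h0, zero_mul]
        rw [this, zero_mul]; exact mul_nonneg (hV0 x z) (hθ S)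
      have hgp : 0 < g z x := lt_of_le_of_ne (hg0 z x) (Ne.symm h0)
      have hle : condAvg p S (Vt z) x ≤ θ S * g z x := by
        refine (condAvg_mono hp S (hVtV z) x).trans ?_
        by_contra hcon
        exact hb ⟨S, hUS, not_le.1 hcon⟩
      rw [e]
      have : B z x * ((√(g z x))⁻¹ * condAvg p S (Vt z) x) =
          Vt z x * (condAvg p S (Vt z) x / g z x) := by
        have hs : (√(g z x))⁻¹ * (√(g z x))⁻¹ = (g z x)⁻¹ := by
          rw [← mul_inv, Real.mul_self_sqrt (hg0 z x)]
        simp only [B]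
        rw [div_eq_mul_inv, ← hs]; ring
      rw [this]
      exact mul_le_mul (hVtV z x) ((div_le_iff₀ hgp).2 hle)
        (div_nonneg (condAvg_nonneg hp S (hVt z) x) hgp.le) (hV0 x z)
    calc _ ≤ ∑ z, ∑ x, prodLaw p x * (V x z * θ S) :=
          Finset.sum_le_sum fun z _ => Finset.sum_le_sum fun x _ =>
            mul_le_mul_of_nonneg_left (hpt z x) (prodLaw_nonneg hp x)
      _ = θ S := by
          rw [Finset.sum_comm]
          simp only [← Finset.mul_sum, ← Finset.sum_mul, hV1, one_mul, sum_prodLaw hp]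
  have gsum : ∑ z, ∑ c : ∀ k, Fin (M k) → Y k, codeLaw p M c * g z (headWord hM c) = 1 := by
    simp only [head, hg, sum_mul_condAvg hp]
    rw [Finset.sum_comm]
    simp only [← Finset.mul_sum, hV1, mul_one, sum_prodLaw hp]
  have mean : ∑ c : ∀ k, Fin (M k) → Y k, codeLaw p M c *
      ∑ z, |codeAvg c (fun x => V x z) - condAvg p U (fun x => V x z) (headWord hM c)| ≤
      2 * ∑ z, ∑ x, prodLaw p x * Vb z x +
        (t + (∑ S ∈ Finset.univ.filter (fun S => U ⊂ S),
          (∏ k ∈ S, (M k : ℝ))⁻¹ * θ S) / t) / 2 := by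
    calc _ ≤ ∑ c : ∀ k, Fin (M k) → Y k, codeLaw p M c * ∑ z,
          (codeAvg c (Vb z) + condAvg p U (Vb z) (headWord hM c) +
        (t * g z (headWord hM c) +
          (codeAvg c (B z) - condAvg p U (B z) (headWord hM c)) ^ 2 / t) / 2) :=
          Finset.sum_le_sum fun c _ => mul_le_mul_of_nonneg_left
            (Finset.sum_le_sum fun z _ => point c z) (hc0 c)
      _ = (∑ z, ∑ c : ∀ k, Fin (M k) → Y k, codeLaw p M c * codeAvg c (Vb z)) +
          (∑ z, ∑ c : ∀ k, Fin (M k) → Y k, codeLaw p M c * condAvg p U (Vb z) (headWord hM c)) +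
          (t * (∑ z, ∑ c : ∀ k, Fin (M k) → Y k, codeLaw p M c * g z (headWord hM c)) +
          (∑ z, ∑ c : ∀ k, Fin (M k) → Y k, codeLaw p M c *
            (codeAvg c (B z) - condAvg p U (B z) (headWord hM c)) ^ 2) / t) / 2 := by
          simp only [Finset.mul_sum, Finset.sum_div, ← Finset.sum_add_distrib]
          rw [Finset.sum_comm]
          refine Finset.sum_congr rfl fun z _ => ?_
          exact Finset.sum_congr rfl fun c _ => by ring
      _ ≤ _ := by
          rw [gsum]
          simp only [head, sum_codeLaw_codeAvg hp hM, sum_mul_condAvg hp]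
          have := div_le_div_of_nonneg_right second ht.le
          linarith
  by_contra hcon
  push Not at hcon
  have hsum1 : ∑ c : ∀ k, Fin (M k) → Y k, codeLaw p M c = 1 :=
    sum_prodLaw (codeLaw_isPmf hp M)
  obtain ⟨c, -, hcpos⟩ : ∃ c ∈ (Finset.univ : Finset (∀ k, Fin (M k) → Y k)),
      codeLaw p M c ≠ 0 := Finset.exists_ne_zero_of_sum_ne_zero (by rw [hsum1]; norm_num)
  refine absurd mean (not_le.2 ?_)
  rw [← one_mul (2 * _ + _), ← hsum1, Finset.sum_mul]
  exact Finset.sum_lt_sum (fun c _ => mul_le_mul_of_nonneg_left (hcon c).le (hc0 c))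
    ⟨c, Finset.mem_univ c,
      mul_lt_mul_of_pos_left (hcon c) (lt_of_le_of_ne (hc0 c) (Ne.symm hcpos))⟩

end SoftCovering

section Memoryless

set_option linter.unusedSectionVars false

variable {K : ℕ} {𝒳 : Fin K → Type} [∀ k, Fintype (𝒳 k)] {𝒵 : Type} [Fintype 𝒵]

/-- The `n`-fold i.i.d. extension of the laws `P k`. -/
def iidLaw (P : ∀ k, 𝒳 k → ℝ) (n : ℕ) (k : Fin K) (y : Fin n → 𝒳 k) : ℝ := ∏ i, P k (y i)

theorem iidLaw_isPmf {P : ∀ k, 𝒳 k → ℝ} (hP : ∀ k, (∀ x, 0 ≤ P k x) ∧ ∑ x, P k x = 1) (n : ℕ)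
    (k : Fin K) : (∀ y, 0 ≤ iidLaw P n k y) ∧ ∑ y, iidLaw P n k y = 1 :=
  ⟨fun _ => Finset.prod_nonneg fun _ _ => (hP k).1 _, by
    simp only [iidLaw]
    rw [sum_prod_apply (fun _ : Fin n => P k)]; simp [(hP k).2]⟩

theorem prodLaw_iidLaw (P : ∀ k, 𝒳 k → ℝ) (n : ℕ) (x : ∀ k, Fin n → 𝒳 k) :
    prodLaw (iidLaw P n) x = ∏ i, prodLaw P fun k => x k i :=
  Finset.prod_comm

theorem sum_prod_letters {n : ℕ} (f : Fin n → (∀ k, 𝒳 k) → ℝ) :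
    ∑ x : ∀ k, Fin n → 𝒳 k, ∏ i, f i (fun k => x k i) = ∏ i, ∑ a, f i a := by
  rw [← sum_prod_apply]
  exact Fintype.sum_equiv (Equiv.piComm fun (k : Fin K) (_ : Fin n) => 𝒳 k) _ _ fun x => rfl

theorem sum_prod_letters_pow (n : ℕ) (f : (∀ k, 𝒳 k) → 𝒵 → ℝ) :
    ∑ z : Fin n → 𝒵, ∑ x : ∀ k, Fin n → 𝒳 k, ∏ i, f (fun k => x k i) (z i) =
      (∑ b, ∑ a, f a b) ^ n := by
  calc _ = ∑ z : Fin n → 𝒵, ∏ i, ∑ a, f a (z i) :=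
        Finset.sum_congr rfl fun z _ => sum_prod_letters fun i a => f a (z i)
    _ = _ := by
        rw [sum_prod_apply (fun (_ : Fin n) (b : 𝒵) => ∑ a, f a b)]; simp

theorem condAvg_Wn (W : (∀ k, 𝒳 k) → 𝒵 → ℝ) (P : ∀ k, 𝒳 k → ℝ) (S : Finset (Fin K)) (n : ℕ)
    (z : Fin n → 𝒵) (x : ∀ k, Fin n → 𝒳 k) :
    condAvg (iidLaw P n) S (fun x => Wn W n x z) x =
      ∏ i, condAvg P S (fun a => W a (z i)) (fun k => x k i) := by
  have : ∀ x' : ∀ k, Fin n → 𝒳 k, prodLaw (iidLaw P n) x' * Wn W n (S.piecewise x x') z =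
      ∏ i, prodLaw P (fun k => x' k i) *
        W (S.piecewise (fun k => x k i) (fun k => x' k i)) (z i) := by
    intro x'
    rw [prodLaw_iidLaw, Wn, ← Finset.prod_mul_distrib]
    refine Finset.prod_congr rfl fun i _ => ?_
    congr 2
    ext k
    by_cases hk : k ∈ S <;> simp [hk]
  simp only [condAvg, this]
  exact sum_prod_letters fun i a =>
    prodLaw P a * W (S.piecewise (fun k => x k i) a) (z i)

/-- Moment of order `s` of the likelihood ratio normalised by `τ`. -/
def ratioMoment (W : (∀ k, 𝒳 k) → 𝒵 → ℝ) (P : ∀ k, 𝒳 k → ℝ) (U S : Finset (Fin K))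
    (τ s : ℝ) : ℝ :=
  ∑ b, ∑ a, prodLaw P a * W a b *
    (condAvg P S (fun a => W a b) a / (τ * condAvg P U (fun a => W a b) a)) ^ s

variable {W : (∀ k, 𝒳 k) → 𝒵 → ℝ} {P : ∀ k, 𝒳 k → ℝ}

theorem mul_le_condAvg (hP : ∀ k, (∀ x, 0 ≤ P k x) ∧ ∑ x, P k x = 1) (S : Finset (Fin K))
    {f : (∀ k, 𝒳 k) → ℝ} (hf : ∀ x, 0 ≤ f x) (x : ∀ k, 𝒳 k) :
    prodLaw P x * f x ≤ condAvg P S f x := by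
  have := Finset.single_le_sum (f := fun x' => prodLaw P x' * f (S.piecewise x x'))
    (fun x' _ => mul_nonneg (prodLaw_nonneg hP x') (hf _)) (Finset.mem_univ x)
  have hx : S.piecewise x x = x := by ext k; simp [Finset.piecewise]
  simpa only [condAvg, hx] using this

theorem atypical_le (hP : ∀ k, (∀ x, 0 ≤ P k x) ∧ ∑ x, P k x = 1)
    (hW : ∀ x z, 0 ≤ W x z) (U : Finset (Fin K)) {τ s : Finset (Fin K) → ℝ}
    (hτ : ∀ S, 0 < τ S) (hs : ∀ S, 0 < s S) (n : ℕ) :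
    ∑ z : Fin n → 𝒵, ∑ x, prodLaw (iidLaw P n) x *
      (if ∃ S, U ⊂ S ∧ τ S ^ n * condAvg (iidLaw P n) U (fun x => Wn W n x z) x <
          condAvg (iidLaw P n) S (fun x => Wn W n x z) x then Wn W n x z else 0) ≤
      ∑ S ∈ Finset.univ.filter (fun S => U ⊂ S), ratioMoment W P U S (τ S) (s S) ^ n := by
  let r : Finset (Fin K) → (∀ k, 𝒳 k) → 𝒵 → ℝ := fun S a b =>
    condAvg P S (fun a => W a b) a / (τ S * condAvg P U (fun a => W a b) a)
  have hc0 : ∀ S a b, 0 ≤ condAvg P S (fun a => W a b) a :=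
    fun S a b => condAvg_nonneg hP S (fun a => hW a b) a
  have hr0 : ∀ S a b, 0 ≤ r S a b := fun S a b =>
    div_nonneg (hc0 S a b) (mul_nonneg (hτ S).le (hc0 U a b))
  have hn := iidLaw_isPmf hP n
  have hterm : ∀ S (x : ∀ k, Fin n → 𝒳 k) (z : Fin n → 𝒵), 0 ≤
      ∏ i, (prodLaw P (fun k => x k i) * W (fun k => x k i) (z i) *
        r S (fun k => x k i) (z i) ^ s S) := fun S x z =>
    Finset.prod_nonneg fun i _ => mul_nonneg (mul_nonneg (prodLaw_nonneg hP _) (hW _ _))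
      (Real.rpow_nonneg (hr0 _ _ _) _)
  have hWn : ∀ x z, 0 ≤ Wn W n x z := fun x z => Finset.prod_nonneg fun _ _ => hW _ _
  have point : ∀ (z : Fin n → 𝒵) x, prodLaw (iidLaw P n) x *
      (if ∃ S, U ⊂ S ∧ τ S ^ n * condAvg (iidLaw P n) U (fun x => Wn W n x z) x <
          condAvg (iidLaw P n) S (fun x => Wn W n x z) x then Wn W n x z else 0) ≤
      ∑ S ∈ Finset.univ.filter (fun S => U ⊂ S),
        ∏ i, (prodLaw P (fun k => x k i) * W (fun k => x k i) (z i) *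
          r S (fun k => x k i) (z i) ^ s S) := by
    intro z x
    split_ifs with h
    swap
    · rw [mul_zero]; exact Finset.sum_nonneg fun S _ => hterm S x z
    obtain ⟨S, hUS, hlt⟩ := h
    refine le_trans ?_ (Finset.single_le_sum (f := fun S =>
      ∏ i, (prodLaw P (fun k => x k i) * W (fun k => x k i) (z i) *
          r S (fun k => x k i) (z i) ^ s S)) (fun R _ => hterm R x z)
      (Finset.mem_filter.2 ⟨Finset.mem_univ S, hUS⟩))
    by_cases h0 : prodLaw (iidLaw P n) x * Wn W n x z = 0
    · rw [h0]; exact hterm S x z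
    have hpos : 0 < condAvg (iidLaw P n) U (fun x => Wn W n x z) x :=
      lt_of_lt_of_le (lt_of_le_of_ne (mul_nonneg (prodLaw_nonneg hn x) (hWn x z)) (Ne.symm h0))
        (mul_le_condAvg hn U (fun x => hWn x z) x)
    have hprod : ∏ i, r S (fun k => x k i) (z i) =
        condAvg (iidLaw P n) S (fun x => Wn W n x z) x /
          (τ S ^ n * condAvg (iidLaw P n) U (fun x => Wn W n x z) x) := by
      simp only [r, Finset.prod_div_distrib, Finset.prod_mul_distrib, condAvg_Wn]
      simp
    have hone : 1 ≤ ∏ i, r S (fun k => x k i) (z i) ^ s S := by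
      rw [Real.finsetProd_rpow _ _ (fun i _ => hr0 _ _ _), hprod]
      refine Real.one_le_rpow ?_ (hs S).le
      rw [one_le_div (mul_pos (pow_pos (hτ S) n) hpos)]
      exact hlt.le
    rw [Finset.prod_mul_distrib, Finset.prod_mul_distrib, ← prodLaw_iidLaw]
    exact le_mul_of_one_le_right (mul_nonneg (prodLaw_nonneg hn x) (hWn x z)) hone
  calc _ ≤ ∑ z : Fin n → 𝒵, ∑ x : ∀ k, Fin n → 𝒳 k,
        ∑ S ∈ Finset.univ.filter (fun S => U ⊂ S),
        ∏ i, (prodLaw P (fun k => x k i) * W (fun k => x k i) (z i) *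
          r S (fun k => x k i) (z i) ^ s S) :=
        Finset.sum_le_sum fun z _ => Finset.sum_le_sum fun x _ => point z x
    _ = ∑ S ∈ Finset.univ.filter (fun S => U ⊂ S), ∑ z : Fin n → 𝒵, ∑ x : ∀ k, Fin n → 𝒳 k,
        ∏ i, (prodLaw P (fun k => x k i) * W (fun k => x k i) (z i) *
          r S (fun k => x k i) (z i) ^ s S) :=
        (Finset.sum_congr rfl fun z _ => Finset.sum_comm).trans Finset.sum_comm
    _ = _ := by
        refine Finset.sum_congr rfl fun S _ => ?_
        exact sum_prod_letters_pow n fun a b => prodLaw P a * W a b * r S a b ^ s S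

/-- Negative drift yields a positive exponent whose moment is below one. -/
theorem exists_rpow_moment_lt_one {Ω : Type} [Fintype Ω] {q a : Ω → ℝ} (hq : ∀ ω, 0 ≤ q ω)
    (hq1 : ∑ ω, q ω = 1) (ha : ∀ ω, 0 < q ω → 0 < a ω)
    (hlog : ∑ ω, q ω * Real.log (a ω) < 0) : ∃ s > (0 : ℝ), ∑ ω, q ω * a ω ^ s < 1 := by
  have hd : HasDerivAt (fun s : ℝ => ∑ ω, q ω * a ω ^ s) (∑ ω, q ω * Real.log (a ω)) 0 := by
    refine HasDerivAt.fun_sum fun ω _ => ?_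
    by_cases h : q ω = 0
    · simpa [h] using hasDerivAt_const (0 : ℝ) (0 : ℝ)
    · have := (Real.hasStrictDerivAt_const_rpow
        (ha ω (lt_of_le_of_ne (hq ω) (Ne.symm h))) 0).hasDerivAt.const_mul (q ω)
      simpa using this
  have h0 : ∑ ω, q ω * a ω ^ (0 : ℝ) = 1 := by simpa using hq1
  have hev := (hasDerivAt_iff_tendsto_slope.1 hd).eventually_lt_const hlog
  have hev2 : ∀ᶠ s in nhdsWithin (0 : ℝ) (Set.Ioi 0),
      slope (fun s : ℝ => ∑ ω, q ω * a ω ^ s) 0 s < 0 :=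
    hev.filter_mono (nhdsWithin_mono _ fun s hs => (ne_of_gt hs))
  obtain ⟨s, hs, hs0⟩ := (hev2.and self_mem_nhdsWithin).exists
  have hs0 : 0 < s := hs0
  refine ⟨s, hs0, ?_⟩
  rw [slope_def_field, h0, sub_zero, div_lt_iff₀ hs0] at hs
  linarith

theorem Hent_eq_sum {Ω α : Type} [Fintype Ω] [Fintype α] (q : Ω → ℝ) (X : Ω → α) :
    Hent q X = -∑ ω, q ω * Real.logb 2 (probOf q X (X ω)) := by
  unfold Hent
  congr 1
  calc _ = ∑ x, ∑ ω, (if X ω = x then q ω * Real.logb 2 (probOf q X x) else 0) := by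
        refine Finset.sum_congr rfl fun x _ => ?_
        refine (Finset.sum_mul _ _ _).trans ?_
        exact Finset.sum_congr rfl fun ω _ => by split_ifs <;> simp
    _ = _ := by
        rw [Finset.sum_comm]
        simp

/-- Joint law of the inputs and the output of a single channel use. -/
def jointLaw (P : ∀ k, 𝒳 k → ℝ) (W : (∀ k, 𝒳 k) → 𝒵 → ℝ) (ω : (∀ k, 𝒳 k) × 𝒵) : ℝ :=
  (∏ j, P j (ω.1 j)) * W ω.1 ω.2

theorem probOf_jointLaw_inputs (hP : ∀ k, (∀ x, 0 ≤ P k x) ∧ ∑ x, P k x = 1)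
    (hW1 : ∀ x, ∑ z, W x z = 1) {α : Type} (X : (∀ k, 𝒳 k) × 𝒵 → α) (R : Finset (Fin K))
    (ω₀ : (∀ k, 𝒳 k) × 𝒵) (hX : ∀ ω, X ω = X ω₀ ↔ ∀ k ∈ R, ω.1 k = ω₀.1 k) :
    probOf (jointLaw P W) X (X ω₀) = ∏ k ∈ R, P k (ω₀.1 k) := by
  have h := sum_prodLaw_indicator hP R ω₀.1 (fun _ => 1)
  have h1 : condAvg P R (fun _ => 1) ω₀.1 = 1 := by
    simp [condAvg, sum_prodLaw hP]
  rw [h1, mul_one] at h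
  rw [← h]
  simp only [probOf, hX, Fintype.sum_prod_type, jointLaw]
  refine Finset.sum_congr rfl fun x _ => ?_
  split_ifs
  · rw [← Finset.mul_sum, hW1]; rfl
  · simp

theorem probOf_jointLaw_inputs_output (hP : ∀ k, (∀ x, 0 ≤ P k x) ∧ ∑ x, P k x = 1)
    {α : Type} (X : (∀ k, 𝒳 k) × 𝒵 → α) (R : Finset (Fin K)) (ω₀ : (∀ k, 𝒳 k) × 𝒵)
    (hX : ∀ ω, X ω = X ω₀ ↔ (∀ k ∈ R, ω.1 k = ω₀.1 k) ∧ ω.2 = ω₀.2) :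
    probOf (jointLaw P W) X (X ω₀) =
      (∏ k ∈ R, P k (ω₀.1 k)) * condAvg P R (fun a => W a ω₀.2) ω₀.1 := by
  rw [← sum_prodLaw_indicator hP R ω₀.1 (fun a => W a ω₀.2)]
  simp only [probOf, hX, Fintype.sum_prod_type, jointLaw]
  refine Finset.sum_congr rfl fun x _ => ?_
  by_cases h : ∀ k ∈ R, x k = ω₀.1 k
  · rw [if_pos h, Finset.sum_eq_single ω₀.2 (fun z _ hz => by simp [hz]) (by simp)]
    rw [if_pos ⟨h, rfl⟩]; rfl
  · simp [h]

theorem tup_eq_iff (S : Finset (Fin K)) (ω ω₀ : (∀ k, 𝒳 k) × 𝒵) :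
    tup (fun k (ω : (∀ j, 𝒳 j) × 𝒵) => ω.1 k) S ω =
      tup (fun k (ω : (∀ j, 𝒳 j) × 𝒵) => ω.1 k) S ω₀ ↔ ∀ k ∈ S, ω.1 k = ω₀.1 k := by
  simp [tup, funext_iff]

theorem IcondMut_jointLaw (hP : ∀ k, (∀ x, 0 ≤ P k x) ∧ ∑ x, P k x = 1)
    (hW : ∀ x, (∀ z, 0 ≤ W x z) ∧ ∑ z, W x z = 1) (S U : Finset (Fin K)) :
    IcondMut (jointLaw P W) (tup (fun k (ω : (∀ j, 𝒳 j) × 𝒵) => ω.1 k) S) (fun ω => ω.2)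
        (tup (fun k (ω : (∀ j, 𝒳 j) × 𝒵) => ω.1 k) U) =
      ∑ ω, jointLaw P W ω * Real.logb 2
        (condAvg P (S ∪ U) (fun a => W a ω.2) ω.1 / condAvg P U (fun a => W a ω.2) ω.1) := by
  set A := tup (fun k (ω : (∀ j, 𝒳 j) × 𝒵) => ω.1 k) S with hA
  set C := tup (fun k (ω : (∀ j, 𝒳 j) × 𝒵) => ω.1 k) U with hC
  have hAC : ∀ ω₀, probOf (jointLaw P W) (fun ω => (A ω, C ω)) (A ω₀, C ω₀) =
      ∏ k ∈ S ∪ U, P k (ω₀.1 k) := fun ω₀ =>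
    probOf_jointLaw_inputs hP (fun x => (hW x).2) (fun ω => (A ω, C ω)) (S ∪ U) ω₀ fun ω => by
      simp only [Prod.mk.injEq, hA, hC, tup_eq_iff, Finset.mem_union, or_imp, forall_and]
  have hCC : ∀ ω₀, probOf (jointLaw P W) C (C ω₀) = ∏ k ∈ U, P k (ω₀.1 k) := fun ω₀ =>
    probOf_jointLaw_inputs hP (fun x => (hW x).2) C U ω₀ fun ω => tup_eq_iff U ω ω₀
  have hZC : ∀ ω₀, probOf (jointLaw P W) (fun ω => (ω.2, C ω)) (ω₀.2, C ω₀) =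
      (∏ k ∈ U, P k (ω₀.1 k)) * condAvg P U (fun a => W a ω₀.2) ω₀.1 := fun ω₀ =>
    probOf_jointLaw_inputs_output hP (fun ω => (ω.2, C ω)) U ω₀ fun ω => by
      simp only [Prod.mk.injEq, hC, tup_eq_iff, and_comm]
  have hAZC : ∀ ω₀, probOf (jointLaw P W) (fun ω => ((A ω, ω.2), C ω)) ((A ω₀, ω₀.2), C ω₀) =
      (∏ k ∈ S ∪ U, P k (ω₀.1 k)) * condAvg P (S ∪ U) (fun a => W a ω₀.2) ω₀.1 := fun ω₀ =>
    probOf_jointLaw_inputs_output hP (fun ω => ((A ω, ω.2), C ω)) (S ∪ U) ω₀ fun ω => by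
      simp only [Prod.mk.injEq, hA, hC, tup_eq_iff, Finset.mem_union, or_imp, forall_and]
      tauto
  simp only [IcondMut, condHent, Hent_eq_sum, hAC, hCC, hZC, hAZC]
  simp only [sub_neg_eq_add, neg_add_eq_sub, ← Finset.sum_sub_distrib,
    ← Finset.sum_add_distrib]
  refine Finset.sum_congr rfl fun ω _ => ?_
  by_cases h0 : jointLaw P W ω = 0
  · simp [h0]
  have hPk : ∀ k, P k (ω.1 k) ≠ 0 := fun k hk => h0 (by
    rw [jointLaw, Finset.prod_eq_zero (Finset.mem_univ k) hk, zero_mul])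
  have hR : ∀ R : Finset (Fin K), ∏ k ∈ R, P k (ω.1 k) ≠ 0 := fun R =>
    Finset.prod_ne_zero_iff.2 fun k _ => hPk k
  have hcond : ∀ R : Finset (Fin K), condAvg P R (fun a => W a ω.2) ω.1 ≠ 0 := fun R =>
    (lt_of_lt_of_le (lt_of_le_of_ne
      (mul_nonneg (prodLaw_nonneg hP ω.1) ((hW ω.1).1 ω.2)) (Ne.symm h0))
      (mul_le_condAvg hP R (fun a => (hW a).1 ω.2) ω.1)).ne'
  rw [Real.logb_div (hcond _) (hcond _), Real.logb_mul (hR _) (hcond _),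
    Real.logb_mul (hR _) (hcond _)]
  ring

theorem sum_jointLaw (hP : ∀ k, (∀ x, 0 ≤ P k x) ∧ ∑ x, P k x = 1)
    (hW1 : ∀ x, ∑ z, W x z = 1) : ∑ ω, jointLaw P W ω = 1 := by
  simp only [jointLaw, Fintype.sum_prod_type, ← Finset.mul_sum, hW1, mul_one]
  exact sum_prodLaw hP

/-- A rate above the conditional information leaves room for a threshold `τ` below the rate at
which some normalised moment of the likelihood ratio is below one. -/
theorem exists_ratioMoment_lt_one (hP : ∀ k, (∀ x, 0 ≤ P k x) ∧ ∑ x, P k x = 1)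
    (hW : ∀ x, (∀ z, 0 ≤ W x z) ∧ ∑ z, W x z = 1) {S U : Finset (Fin K)} {R : ℝ}
    (hR : IcondMut (jointLaw P W) (tup (fun k (ω : (∀ j, 𝒳 j) × 𝒵) => ω.1 k) S) (fun ω => ω.2)
        (tup (fun k (ω : (∀ j, 𝒳 j) × 𝒵) => ω.1 k) U) < R) :
    ∃ τ > (0 : ℝ), ∃ s > (0 : ℝ), τ < 2 ^ R ∧ ratioMoment W P U (S ∪ U) τ s < 1 := by
  obtain ⟨J, hIJ, hJR⟩ := exists_between hR
  have hτ : (0 : ℝ) < 2 ^ J := by positivity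
  rw [IcondMut_jointLaw hP hW] at hIJ
  have hq : ∀ ω, 0 ≤ jointLaw P W ω := fun ω =>
    mul_nonneg (prodLaw_nonneg hP ω.1) ((hW ω.1).1 ω.2)
  have hcond : ∀ ω, 0 < jointLaw P W ω → ∀ R : Finset (Fin K),
      0 < condAvg P R (fun a => W a ω.2) ω.1 := fun ω h R =>
    lt_of_lt_of_le h (mul_le_condAvg hP R (fun a => (hW a).1 ω.2) ω.1)
  have hlog : ∑ ω, jointLaw P W ω * Real.log (condAvg P (S ∪ U) (fun a => W a ω.2) ω.1 /
      (2 ^ J * condAvg P U (fun a => W a ω.2) ω.1)) < 0 := by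
    have hl2 : 0 < Real.log 2 := Real.log_pos (by norm_num)
    have : ∀ ω, jointLaw P W ω * Real.log (condAvg P (S ∪ U) (fun a => W a ω.2) ω.1 /
        (2 ^ J * condAvg P U (fun a => W a ω.2) ω.1)) =
        Real.log 2 * (jointLaw P W ω * Real.logb 2
        (condAvg P (S ∪ U) (fun a => W a ω.2) ω.1 / condAvg P U (fun a => W a ω.2) ω.1) -
          jointLaw P W ω * J) := by
      intro ω
      by_cases h0 : jointLaw P W ω = 0
      · simp [h0]
      have hc := hcond ω (lt_of_le_of_ne (hq ω) (Ne.symm h0))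
      rw [Real.logb, Real.log_div (hc _).ne' (mul_pos hτ (hc _)).ne',
        Real.log_mul hτ.ne' (hc _).ne', Real.log_div (hc _).ne' (hc _).ne',
        Real.log_rpow (by norm_num)]
      field_simp
      ring
    simp only [this]
    rw [← Finset.mul_sum, Finset.sum_sub_distrib, ← Finset.sum_mul,
      sum_jointLaw hP fun x => (hW x).2, one_mul]
    exact mul_neg_of_pos_of_neg hl2 (by linarith)
  obtain ⟨s, hs, hlt⟩ := exists_rpow_moment_lt_one hq (sum_jointLaw hP fun x => (hW x).2)
    (fun ω h => div_pos (hcond ω h _) (mul_pos hτ (hcond ω h _))) hlog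
  refine ⟨2 ^ J, hτ, s, hs, Real.rpow_lt_rpow_of_exponent_lt (by norm_num) hJR, ?_⟩
  rw [ratioMoment, Finset.sum_comm, ← Fintype.sum_prod_type']
  exact hlt

theorem ratioMoment_nonneg (hP : ∀ k, (∀ x, 0 ≤ P k x) ∧ ∑ x, P k x = 1)
    (hW : ∀ x z, 0 ≤ W x z) (U S : Finset (Fin K)) {τ : ℝ} (hτ : 0 ≤ τ) (s : ℝ) :
    0 ≤ ratioMoment W P U S τ s :=
  Finset.sum_nonneg fun b _ => Finset.sum_nonneg fun a _ =>
    mul_nonneg (mul_nonneg (prodLaw_nonneg hP a) (hW a b)) (Real.rpow_nonneg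
      (div_nonneg (condAvg_nonneg hP S (fun a => hW a b) a)
        (mul_nonneg hτ (condAvg_nonneg hP U (fun a => hW a b) a))) _)

theorem Msize_pos (Q : Fin K → ℝ) (n : ℕ) (k : Fin K) : 0 < Msize Q n k :=
  Nat.ceil_pos.2 (by positivity)

theorem Msize_of_rate_zero {Q : Fin K → ℝ} (n : ℕ) {k : Fin K} (h : Q k = 0) :
    Msize Q n k = 1 := by
  simp [Msize, h]

theorem rate_pow_le_prod_Msize (Q : Fin K → ℝ) (n : ℕ) (S : Finset (Fin K)) :
    ((2 : ℝ) ^ ∑ k ∈ S, Q k) ^ n ≤ ∏ k ∈ S, (Msize Q n k : ℝ) := by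
  rw [← Real.rpow_natCast, ← Real.rpow_mul (by norm_num), mul_comm, Finset.mul_sum,
    Real.rpow_sum_of_pos (by norm_num)]
  exact Finset.prod_le_prod (fun _ _ => by positivity) fun k _ => Nat.le_ceil _

theorem PoutPartial_eq_condAvg (hP : ∀ k, (∀ x, 0 ≤ P k x) ∧ ∑ x, P k x = 1)
    {Q : Fin K → ℝ} {K' : Finset (Fin K)} (hQ0 : ∀ k ∈ Finset.univ \ K', Q k = 0) (n : ℕ)
    (c : ∀ k, Fin (Msize Q n k) → Fin n → 𝒳 k) (z : Fin n → 𝒵) :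
    PoutPartial W P Q K' n c z =
      condAvg (iidLaw P n) (Finset.univ \ K') (fun x => Wn W n x z)
        (headWord (Msize_pos Q n) c) := by
  have hM1 : ∀ k ∈ Finset.univ \ K', Msize Q n k = 1 := fun k hk =>
    Msize_of_rate_zero n (hQ0 k hk)
  have hsub : Subsingleton
      (∀ k : (Finset.univ \ K' : Finset (Fin K)), Fin (Msize Q n k.1)) := by
    refine ⟨fun a b => funext fun k => ?_⟩
    have h1 := (a k).2
    have h2 := (b k).2
    have h3 := hM1 k.1 k.2
    exact Fin.ext (by omega)
  unfold PoutPartial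
  rw [Finset.prod_congr rfl (fun k hk => by rw [hM1 k hk] :
    ∀ k ∈ Finset.univ \ K', (Msize Q n k : ℝ) = ((1 : ℕ) : ℝ)),
    Fintype.sum_subsingleton _ (fun k => ⟨0, Msize_pos Q n k.1⟩)]
  simp only [Nat.cast_one, Finset.prod_const_one, inv_one, one_mul]
  symm
  let e := Equiv.piEquivPiSubtypeProd (fun k => k ∈ K') (fun k => Fin n → 𝒳 k)
  have h : ∀ q, prodLaw (iidLaw P n) (e.symm q) *
      Wn W n ((Finset.univ \ K').piecewise (headWord (Msize_pos Q n) c) (e.symm q)) z =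
      ((∏ k : K', ∏ i, P k.1 (q.1 k i)) * Wn W n (fun k i =>
        if h : k ∈ K' then q.1 ⟨k, h⟩ i else c k ⟨0, Msize_pos Q n k⟩ i) z) *
      ∏ k : {k // k ∉ K'}, iidLaw P n k.1 (q.2 k) := by
    intro q
    have h1 : prodLaw (iidLaw P n) (e.symm q) = (∏ k : K', ∏ i, P k.1 (q.1 k i)) *
        ∏ k : {k // k ∉ K'}, iidLaw P n k.1 (q.2 k) := by
      rw [prodLaw, ← Fintype.prod_subtype_mul_prod_subtype (fun k => k ∈ K')]
      congr 1
      · refine Finset.prod_congr (by ext; simp) fun k _ => ?_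
        simp [e, Equiv.piEquivPiSubtypeProd, iidLaw]
      · refine Finset.prod_congr rfl fun k _ => ?_
        simp [e, Equiv.piEquivPiSubtypeProd, iidLaw, k.2]
    have h2 : (Finset.univ \ K').piecewise (headWord (Msize_pos Q n) c) (e.symm q) =
        fun k i => if h : k ∈ K' then q.1 ⟨k, h⟩ i else c k ⟨0, Msize_pos Q n k⟩ i := by
      funext k i
      by_cases hk : k ∈ K' <;> simp [hk, headWord, e, Equiv.piEquivPiSubtypeProd]
    rw [h1, h2]; ring
  have hone : ∑ y : ∀ k : {k // k ∉ K'}, Fin n → 𝒳 k.1,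
      ∏ k : {k // k ∉ K'}, iidLaw P n k.1 (y k) = 1 := by
    rw [sum_prod_apply (fun k : {k // k ∉ K'} => iidLaw P n k.1)]
    simp [(iidLaw_isPmf hP n _).2]
  unfold condAvg
  rw [← Equiv.sum_comp e.symm]
  simp only [h]
  rw [Fintype.sum_prod_type]
  simp only [← Finset.mul_sum, hone, mul_one]

theorem exists_common_rate {α : Type} [Fintype α] {a b : α → ℝ} (ha : ∀ i, a i < 1)
    (hb : ∀ i, b i < 1) : ∃ r : ℝ, 0 < r ∧ r < 1 ∧ ∀ i, a i ≤ r ∧ b i ≤ r ^ 2 := by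
  have ht : Filter.Tendsto (fun r : ℝ => r ^ 2) (nhdsWithin 1 (Set.Iio 1)) (nhds 1) := by
    have : Filter.Tendsto (fun r : ℝ => r ^ 2) (nhds 1) (nhds (1 ^ 2)) :=
      (continuous_pow 2).tendsto 1
    rw [one_pow] at this
    exact this.mono_left nhdsWithin_le_nhds
  have hid : Filter.Tendsto (fun r : ℝ => r) (nhdsWithin 1 (Set.Iio 1)) (nhds 1) :=
    nhdsWithin_le_nhds
  have h1 : ∀ᶠ r in nhdsWithin (1 : ℝ) (Set.Iio 1), ∀ i, a i < r ∧ b i < r ^ 2 :=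
    Filter.eventually_all.2 fun i =>
      (hid.eventually_const_lt (ha i)).and (ht.eventually_const_lt (hb i))
  obtain ⟨r, h, h0, hlt⟩ :=
    (h1.and ((hid.eventually_const_lt one_pos).and self_mem_nhdsWithin)).exists
  exact ⟨r, h0, hlt, fun i => ⟨(h i).1.le, (h i).2.le⟩⟩

theorem exists_exponent {r : ℝ} (h0 : 0 < r) (h1 : r < 1) (C : ℝ) :
    ∃ ε > (0 : ℝ), ∃ N : ℕ, ∀ n ≥ N, C * r ^ n ≤ Real.exp (-(n * ε)) := by
  have hl : Real.log r < 0 := Real.log_neg h0 h1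
  set ρ := Real.exp (Real.log r / 2) with hρ
  have hρ0 : 0 < ρ := Real.exp_pos _
  have hρ1 : ρ < 1 := Real.exp_lt_one_iff.2 (by linarith)
  have hr : r = ρ * ρ := by rw [hρ, ← Real.exp_add, add_halves, Real.exp_log h0]
  have ht : Filter.Tendsto (fun n : ℕ => C * ρ ^ n) Filter.atTop (nhds (C * 0)) :=
    (tendsto_pow_atTop_nhds_zero_of_lt_one hρ0.le hρ1).const_mul C
  rw [mul_zero] at ht
  obtain ⟨N, hN⟩ := Filter.eventually_atTop.1 (ht.eventually_lt_const one_pos)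
  refine ⟨-(Real.log r / 2), by linarith, N, fun n hn => ?_⟩
  have : Real.exp (-(n * -(Real.log r / 2))) = ρ ^ n := by
    rw [hρ, ← Real.exp_nat_mul]; congr 1; ring
  rw [this, hr, mul_pow, ← mul_assoc]
  exact mul_le_of_le_one_left (by positivity) (hN n hn).le

end Memoryless

theorem stmt4 {K : ℕ} (hK : 1 ≤ K)
    {𝒳 : Fin K → Type} [∀ k, Fintype (𝒳 k)] {𝒵 : Type} [Fintype 𝒵]
    (W : (∀ k, 𝒳 k) → 𝒵 → ℝ) (hW : ∀ x, (∀ z, 0 ≤ W x z) ∧ ∑ z, W x z = 1)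
    (P : ∀ k, 𝒳 k → ℝ) (hP : ∀ k, (∀ x, 0 ≤ P k x) ∧ ∑ x, P k x = 1)
    (K' : Finset (Fin K)) (Q : Fin K → ℝ) (hQnn : ∀ k, 0 ≤ Q k)
    (hQ0 : ∀ k ∈ Finset.univ \ K', Q k = 0)
    (hQ : ∀ S ⊆ K', S.Nonempty →
      IcondMut (fun ω : (∀ j, 𝒳 j) × 𝒵 => (∏ j, P j (ω.1 j)) * W ω.1 ω.2)
          (tup (fun k (ω : (∀ j, 𝒳 j) × 𝒵) => ω.1 k) S) (fun ω => ω.2)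
          (tup (fun k (ω : (∀ j, 𝒳 j) × 𝒵) => ω.1 k) (Finset.univ \ K')) <
        ∑ k ∈ S, Q k) :
    ∃ ε > (0 : ℝ), ∃ N : ℕ, ∀ n ≥ N,
      ∃ c : ∀ k, Fin (Msize Q n k) → Fin n → 𝒳 k,
        ∑ z : Fin n → 𝒵, |PoutFull W Q n c z - PoutPartial W P Q K' n c z| ≤
          Real.exp (-(n * ε)) := by
  set U := Finset.univ \ K' with hUdef
  have key : ∀ S : Finset (Fin K), ∃ τs : ℝ × ℝ, 0 < τs.1 ∧ 0 < τs.2 ∧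
      (U ⊂ S → τs.1 < 2 ^ ∑ k ∈ S, Q k ∧ ratioMoment W P U S τs.1 τs.2 < 1) := by
    intro S
    by_cases hS : U ⊂ S
    swap
    · exact ⟨(1, 1), one_pos, one_pos, fun h => absurd h hS⟩
    have hsub : S \ U ⊆ K' := fun k hk => by
      have := (Finset.mem_sdiff.1 hk).2
      simpa [hUdef] using this
    obtain ⟨τ, hτ, s, hs, hlt, hm⟩ := exists_ratioMoment_lt_one hP hW
      (hQ (S \ U) hsub (Finset.sdiff_nonempty.2 hS.2))
    rw [Finset.sdiff_union_of_subset hS.1] at hm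
    refine ⟨(τ, s), hτ, hs, fun _ => ⟨hlt.trans_le ?_, hm⟩⟩
    exact Real.rpow_le_rpow_of_exponent_le (by norm_num)
      (Finset.sum_le_sum_of_subset_of_nonneg Finset.sdiff_subset fun k _ _ => hQnn k)
  choose τs hτ hs hτs using key
  have hWnn : ∀ x z, 0 ≤ W x z := fun x => (hW x).1
  obtain ⟨r, hr0, hr1, hr⟩ := exists_common_rate
    (a := fun S : {S : Finset (Fin K) // U ⊂ S} => ratioMoment W P U S.1 (τs S.1).1 (τs S.1).2)
    (b := fun S : {S : Finset (Fin K) // U ⊂ S} => (τs S.1).1 / 2 ^ ∑ k ∈ S.1, Q k)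
    (fun S => (hτs S.1 S.2).2) (fun S => (div_lt_one (by positivity)).2 (hτs S.1 S.2).1)
  set F : Finset (Finset (Fin K)) := Finset.univ.filter (fun S => U ⊂ S) with hF
  obtain ⟨ε, hε, N, hN⟩ := exists_exponent hr0 hr1 (2 * F.card + (1 + F.card) / 2)
  refine ⟨ε, hε, N, fun n hn => ?_⟩
  have hV1 : ∀ x, ∑ z, Wn W n x z = 1 := by
    intro x
    simp only [Wn]
    rw [sum_prod_apply (fun (i : Fin n) (b : 𝒵) => W (fun k => x k i) b)]
    simp [(hW _).2]
  obtain ⟨c, hc⟩ := exists_codebook_of_threshold (iidLaw_isPmf hP n) (Msize_pos Q n)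
    (fun k hk => Msize_of_rate_zero n (hQ0 k hk))
    (V := fun x z => Wn W n x z) (fun x z => Finset.prod_nonneg fun _ _ => hWnn _ _) hV1
    (θ := fun S => (τs S).1 ^ n) (fun S => pow_nonneg (hτ S).le n) (pow_pos hr0 n)
  refine ⟨c, le_trans ?_ (hN n hn)⟩
  have hfull : ∀ z, PoutFull W Q n c z = codeAvg c (fun x => Wn W n x z) := fun z => rfl
  simp only [hfull, PoutPartial_eq_condAvg hP hQ0]
  refine hc.trans ?_
  have hatyp := (atypical_le hP hWnn U hτ hs n).trans
    (Finset.sum_le_card_nsmul F _ (r ^ n) fun S hS =>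
      pow_le_pow_left₀ (ratioMoment_nonneg hP hWnn U S (hτ S).le _)
        (hr ⟨S, (Finset.mem_filter.1 hS).2⟩).1 n)
  have hvar : ∑ S ∈ F, (∏ k ∈ S, (Msize Q n k : ℝ))⁻¹ * (τs S).1 ^ n ≤ F.card • (r ^ n) ^ 2 := by
    refine Finset.sum_le_card_nsmul F _ _ fun S hS => ?_
    have h2 : (0 : ℝ) < 2 ^ ∑ k ∈ S, Q k := by positivity
    calc (∏ k ∈ S, (Msize Q n k : ℝ))⁻¹ * (τs S).1 ^ n
        ≤ ((2 ^ ∑ k ∈ S, Q k) ^ n)⁻¹ * (τs S).1 ^ n := by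
          refine mul_le_mul_of_nonneg_right ?_ (pow_nonneg (hτ S).le n)
          exact inv_anti₀ (pow_pos h2 n) (rate_pow_le_prod_Msize Q n S)
      _ = ((τs S).1 / 2 ^ ∑ k ∈ S, Q k) ^ n := by rw [div_pow]; field_simp
      _ ≤ (r ^ 2) ^ n := pow_le_pow_left₀ (div_nonneg (hτ S).le h2.le)
          (hr ⟨S, (Finset.mem_filter.1 hS).2⟩).2 n
      _ = _ := by ring
  rw [nsmul_eq_mul] at hatyp hvar
  have hrn : 0 < r ^ n := pow_pos hr0 n
  have hdiv : (∑ S ∈ F, (∏ k ∈ S, (Msize Q n k : ℝ))⁻¹ * (τs S).1 ^ n) / r ^ n ≤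
      F.card * r ^ n := by
    rw [div_le_iff₀ hrn]
    linarith
  calc _ ≤ 2 * (F.card * r ^ n) + (r ^ n + F.card * r ^ n) / 2 :=
        add_le_add (mul_le_mul_of_nonneg_left hatyp (by norm_num))
          (div_le_div_of_nonneg_right (add_le_add le_rfl hdiv) (by norm_num))
    _ = _ := by ring
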